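/- For every ℓ ≥ 1 and every ε : {1,…,ℓ} → {1,*}, there exists a polynomial P with nonnegative real coefficients in the 1 + (ℓ+1)² variables X and (Y_{r,s})_{0≤r,s≤ℓ}, which is weighted-homogeneous of total degree ℓ when X is given weight 2 and Y_{r,s} is given weight r+s, such that the following holds. Let μ be any compactly supported Borel probability measure on ℂ and let c > 0. For each n ≥ 1, let the joint law of (D_n, T_n) be given as follows: D_n = diag(d₁,…,d_n) is a diagonal random matrix whose diagonal entries are i.i.d. with law μ, T_n is a strictly upper triangular random matrix with law GT(n), and D_n and T_n are independent; set Z_n = D_n + c·T_n. Then lim_{n→∞} E[tr_n(Z_n^{ε(1)}·Z_n^{ε(2)}·⋯·Z_n^{ε(ℓ)})] exists and equals P(c², (M_μ(r,s))_{0≤r,s≤ℓ}), where M_μ(r,s) = ∫_ℂ z^r·conj(z)^s dμ(z) and Z_n^{ε(j)} means Z_n if ε(j) = 1 and Z_n* if ε(j) = *. -/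

import Mathlib

open MeasureTheory ProbabilityTheory Matrix
open scoped ENNReal NNReal

/-- The complex Gaussian measure `N_ℂ(0,v)`: the pushforward of `N(0,v/2) × N(0,v/2)` under
`(x,y) ↦ x + iy`. -/
noncomputable def complexGaussian (v : ℝ≥0) : Measure ℂ :=
  ((gaussianReal 0 (v / 2)).prod (gaussianReal 0 (v / 2))).map
    fun p => (p.1 : ℂ) + (p.2 : ℂ) * Complex.I

/-- The law `GT(n)` of a strictly upper triangular `n×n` random matrix with i.i.d. complex
Gaussian `N_ℂ(0,1/n)` entries above the diagonal (and zeros elsewhere). -/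
noncomputable def GTlaw (n : ℕ) : Measure (Fin n → Fin n → ℂ) :=
  Measure.pi fun i => Measure.pi fun j =>
    if (i : ℕ) < (j : ℕ) then complexGaussian ((n : ℝ≥0))⁻¹ else Measure.dirac 0

/-- Weights for the variables of the polynomial `P`: the variable `X` (encoded by `none`,
standing for `c²`) has weight `2`, and the variable `Y_{r,s}` (encoded by `some (r,s)`,
standing for `M_μ(r,s) = ∫ z^r conj(z)^s dμ`) has weight `r + s`. -/
def momentWeight (ℓ : ℕ) : Option (Fin (ℓ + 1) × Fin (ℓ + 1)) → ℕ
  | none => 2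
  | some (r, s) => (r : ℕ) + (s : ℕ)


instance cg_prob (v : ℝ≥0) : IsProbabilityMeasure (complexGaussian v) := by
  unfold complexGaussian
  exact Measure.isProbabilityMeasure_map (by fun_prop)

lemma cg_charFun (v : ℝ≥0) (t : ℂ) :
    charFun (complexGaussian v) t = Complex.exp (-((v : ℝ) * ‖t‖ ^ 2 / 4 : ℝ)) := by
  rw [charFun_apply, complexGaussian, integral_map (by fun_prop) (by fun_prop)]
  have h : ∀ p : ℝ × ℝ, Complex.exp ((inner ℝ ((p.1 : ℂ) + (p.2 : ℂ) * Complex.I) t : ℝ) * Complex.I)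
      = Complex.exp (t.re * p.1 * Complex.I) * Complex.exp (t.im * p.2 * Complex.I) := by
    intro p
    rw [← Complex.exp_add]
    congr 1
    simp [Complex.inner]
    ring
  simp_rw [h]
  rw [integral_prod_mul (fun x : ℝ => Complex.exp (t.re * x * Complex.I))
    (fun x : ℝ => Complex.exp (t.im * x * Complex.I)), ← charFun_apply_real, ← charFun_apply_real,
    charFun_gaussianReal, charFun_gaussianReal, ← Complex.exp_add, Complex.sq_norm, Complex.normSq_apply]
  congr 1
  push_cast
  ring

lemma cg_map (v w : ℝ≥0) (a : ℂ) (h : (w : ℝ) = v * ‖a‖ ^ 2) :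
    (complexGaussian v).map (fun z => a * z) = complexGaussian w := by
  have : IsProbabilityMeasure ((complexGaussian v).map (fun z => a * z)) :=
    Measure.isProbabilityMeasure_map (by fun_prop)
  apply Measure.ext_of_charFun
  funext t
  have h1 : charFun ((complexGaussian v).map (fun z => a * z)) t
      = charFun (complexGaussian v) (starRingEnd ℂ a * t) := by
    rw [charFun_apply, charFun_apply, integral_map (by fun_prop) (by fun_prop)]
    congr 1
    funext z
    congr 3
    simp [Complex.inner]
    ring
  rw [h1, cg_charFun, cg_charFun, h]
  congr 1
  simp
  ring

noncomputable def gmom (a b : ℕ) : ℝ :=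
  if a = b then ∫ z : ℂ, ‖z‖ ^ (2 * a) ∂(complexGaussian 1) else 0

lemma gmom_nonneg (a b : ℕ) : 0 ≤ gmom a b := by
  unfold gmom
  split_ifs
  · exact integral_nonneg fun z => by positivity
  · exact le_rfl

lemma gmom_ne {a b : ℕ} (h : a ≠ b) : gmom a b = 0 := by simp [gmom, h]

lemma gmom_zero : gmom 0 0 = 1 := by simp [gmom]

lemma cg_moment_one (a b : ℕ) :
    ∫ z : ℂ, z ^ a * (starRingEnd ℂ z) ^ b ∂(complexGaussian 1) = (gmom a b : ℂ) := by
  by_cases hab : a = b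
  · subst hab
    simp only [gmom, if_true]
    rw [← integral_complex_ofReal]
    congr 1
    funext z
    rw [← mul_pow, Complex.mul_conj, Complex.normSq_eq_norm_sq]
    push_cast
    rw [pow_mul]
  · rw [gmom_ne hab]
    set J := ∫ z : ℂ, z ^ a * (starRingEnd ℂ z) ^ b ∂(complexGaussian 1) with hJ
    have key : ∀ u : ℂ, ‖u‖ = 1 → J = u ^ a * (starRingEnd ℂ u) ^ b * J := by
      intro u hu
      have := cg_map 1 1 u (by simp [hu])
      conv_lhs => rw [hJ, ← this, integral_map (by fun_prop) (by fun_prop)]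
      rw [hJ, ← integral_const_mul]
      congr 1
      funext z
      simp only [map_mul]
      ring
    -- choose u = exp (i)
    have h1 := key (Complex.exp (Complex.I)) (by simpa using Complex.norm_exp_ofReal_mul_I 1)
    rw [← Complex.exp_conj, ← Complex.exp_nat_mul, ← Complex.exp_nat_mul, ← Complex.exp_add] at h1
    by_contra hne
    have hJ0 : J ≠ 0 := by simpa using hne
    have h2 : Complex.exp (a * Complex.I + b * (starRingEnd ℂ) Complex.I) = 1 := by
      have := mul_right_cancel₀ hJ0 ((one_mul J).trans h1)
      exact this.symm
    rw [Complex.exp_eq_one_iff] at h2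
    obtain ⟨n, hn⟩ := h2
    have h3 := congrArg Complex.im hn
    simp at h3
    have h4 : ((a : ℤ) - (b : ℤ) : ℤ) ≠ 0 := by
      intro h; apply hab; omega
    have hn0 : n ≠ 0 := by
      rintro rfl
      apply h4
      have : (a : ℝ) - b = 0 := by simp at h3; linarith
      exact_mod_cast this
    have hirr := irrational_pi
    apply hirr
    refine ⟨((a : ℤ) - (b : ℤ) : ℤ) / (2 * n : ℤ), ?_⟩
    have : (n : ℝ) ≠ 0 := by exact_mod_cast hn0
    push_cast
    field_simp
    linarith

lemma cg_moment (n : ℕ) (a b : ℕ) :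
    ∫ z : ℂ, z ^ a * (starRingEnd ℂ z) ^ b ∂(complexGaussian (n : ℝ≥0)⁻¹)
      = ((Real.sqrt n)⁻¹ : ℂ) ^ (a + b) * (gmom a b : ℂ) := by
  rw [← cg_moment_one, ← cg_map 1 (n : ℝ≥0)⁻¹ ((Real.sqrt n)⁻¹ : ℂ) (by simp),
    integral_map (by fun_prop) (by fun_prop), ← integral_const_mul]
  congr 1
  funext z
  simp only [map_mul, map_inv₀, Complex.conj_ofReal]
  ring

lemma cg_integrable (v : ℝ≥0) (a b : ℕ) :
    Integrable (fun z : ℂ => z ^ a * (starRingEnd ℂ z) ^ b) (complexGaussian v) := by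
  have h1 : ∀ k : ℕ, MemLp (fun z : ℂ => z) k (complexGaussian v) := by
    intro k
    unfold complexGaussian
    rw [memLp_map_measure_iff (by fun_prop) (by fun_prop)]
    have hx : MemLp (fun p : ℝ × ℝ => p.1) k
        ((gaussianReal 0 (v / 2)).prod (gaussianReal 0 (v / 2))) :=
      (memLp_id_gaussianReal' (k : ℝ≥0∞) (by simp)).comp_measurePreserving measurePreserving_fst
    have hy : MemLp (fun p : ℝ × ℝ => p.2) k
        ((gaussianReal 0 (v / 2)).prod (gaussianReal 0 (v / 2))) :=
      (memLp_id_gaussianReal' (k : ℝ≥0∞) (by simp)).comp_measurePreserving measurePreserving_snd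
    have hx' : MemLp (fun p : ℝ × ℝ => (p.1 : ℂ)) k
        ((gaussianReal 0 (v / 2)).prod (gaussianReal 0 (v / 2))) := hx.ofReal
    have hy' : MemLp (fun p : ℝ × ℝ => (p.2 : ℂ)) k
        ((gaussianReal 0 (v / 2)).prod (gaussianReal 0 (v / 2))) := hy.ofReal
    have hy2 : MemLp (fun p : ℝ × ℝ => (p.2 : ℂ) * Complex.I) k
        ((gaussianReal 0 (v / 2)).prod (gaussianReal 0 (v / 2))) := hy'.mul_const Complex.I
    exact hx'.add hy2
  have h2 : Integrable (fun z : ℂ => ‖z‖ ^ (a + b)) (complexGaussian v) :=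
    (h1 (a + b)).integrable_norm_pow'
  refine h2.mono (by fun_prop) (Filter.Eventually.of_forall fun z => ?_)
  simp [pow_add]

lemma path_prod {N : Type*} [Fintype N] [DecidableEq N] (ℓ : ℕ) (A : Fin ℓ → Matrix N N ℂ) (a b : N) :
    (List.ofFn A).prod a b = ∑ p : Fin (ℓ + 1) → N,
      if p 0 = a ∧ p (Fin.last ℓ) = b then ∏ j, A j (p j.castSucc) (p j.succ) else 0 := by
  induction ℓ generalizing a with
  | zero =>
    rw [← (Equiv.funUnique (Fin 1) N).symm.sum_comp]
    simp [Matrix.one_apply, ite_and]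
  | succ ℓ ih =>
    rw [List.ofFn_succ, List.prod_cons, Matrix.mul_apply]
    simp_rw [ih]
    rw [← (Fin.consEquiv (fun _ => N)).sum_comp, Fintype.sum_prod_type]
    simp only [Fin.consEquiv_apply, Fin.cons_zero, Fin.prod_univ_succ, Fin.cons_succ,
      ← Fin.succ_last, ← Fin.succ_castSucc, Fin.castSucc_zero]
    simp only [ite_and, Finset.sum_ite_irrel, Finset.sum_const_zero]
    simp only [Finset.mul_sum, Finset.sum_ite_eq', Finset.mem_univ, if_true]
    rw [Finset.sum_comm]
    refine Finset.sum_congr rfl fun q _ => ?_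
    simp

lemma path_trace {N : Type*} [Fintype N] [DecidableEq N] (ℓ : ℕ) (A : Fin ℓ → Matrix N N ℂ) :
    ((List.ofFn A).prod).trace = ∑ p : Fin (ℓ + 1) → N,
      if p 0 = p (Fin.last ℓ) then ∏ j, A j (p j.castSucc) (p j.succ) else 0 := by
  simp only [Matrix.trace, Matrix.diag, path_prod]
  rw [Finset.sum_comm]
  refine Finset.sum_congr rfl fun p _ => ?_
  simp [ite_and, eq_comm]

abbrev PatT (ℓ n : ℕ) : Type :=
  Σ k : Fin (ℓ + 2), (Fin (k : ℕ) ↪o Fin n) × {π : Fin (ℓ + 1) → Fin (k : ℕ) // Function.Surjective π}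

lemma pat_bij (ℓ n : ℕ) : Function.Bijective
    (fun x : PatT ℓ n => (fun j => x.2.1 (x.2.2.1 j) : Fin (ℓ + 1) → Fin n)) := by
  constructor
  · rintro ⟨k, e, π, hπ⟩ ⟨k', e', π', hπ'⟩ h
    simp only at h
    have hr : Set.range e = Set.range e' := by
      have h1 : Set.range (fun j => e (π j)) = Set.range e := hπ.range_comp e
      have h2 : Set.range (fun j => e' (π' j)) = Set.range e' := hπ'.range_comp e'
      rw [← h1, ← h2, h]
    have hk : k = k' := by
      have h1 := congrArg Set.ncard hr
      rw [← Set.image_univ, ← Set.image_univ, Set.ncard_image_of_injective _ e.injective,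
        Set.ncard_image_of_injective _ e'.injective] at h1
      simp at h1
      exact Fin.ext h1
    subst hk
    have he : e = e' := by
      apply RelEmbedding.ext
      intro x
      exact congrFun ((StrictMono.range_inj e.strictMono e'.strictMono).1 hr) x
    subst he
    have : π = π' := by
      funext j
      exact e.injective (congrFun h j)
    subst this
    rfl
  · intro p
    set S : Finset (Fin n) := Finset.univ.image p with hS
    have hc : S.card < ℓ + 2 := by
      have : S.card ≤ (Finset.univ : Finset (Fin (ℓ + 1))).card := Finset.card_image_le
      simp at this
      omega
    have hmem : ∀ j, p j ∈ S := fun j => by simp [hS]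
    refine ⟨⟨⟨S.card, hc⟩, S.orderEmbOfFin rfl,
      fun j => (S.orderIsoOfFin rfl).symm ⟨p j, hmem j⟩, ?_⟩, ?_⟩
    · intro i
      have hi := S.orderEmbOfFin_mem rfl i
      obtain ⟨j, -, hj⟩ := Finset.mem_image.1 hi
      refine ⟨j, ?_⟩
      rw [OrderIso.symm_apply_eq]
      exact Subtype.ext hj
    · funext j
      simp only
      rw [← Finset.coe_orderIsoOfFin_apply]
      simp

lemma sum_patterns (ℓ n : ℕ) (F : (Fin (ℓ + 1) → Fin n) → ℂ) :
    ∑ p, F p = ∑ k : Fin (ℓ + 2), ∑ e : Fin (k : ℕ) ↪o Fin n,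
      ∑ π : {π : Fin (ℓ + 1) → Fin (k : ℕ) // Function.Surjective π}, F (fun j => e (π.1 j)) := by
  rw [← Function.Bijective.sum_comp (pat_bij ℓ n), Fintype.sum_sigma]
  simp_rw [Fintype.sum_prod_type]

lemma card_emb (k n : ℕ) : Fintype.card (Fin k ↪o Fin n) = n.choose k := by
  rw [← Nat.card_eq_fintype_card, Nat.card_congr (Set.powersetCard.ofFinEmbEquiv (n := k) (I := Fin n)),
    Set.powersetCard.card]
  simp

lemma first_visit {ℓ : ℕ} {V : Type*} (p : Fin (ℓ + 1) → V) (hp : Function.Surjective p) (v : V) (hv : v ≠ p 0) :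
    ∃ j : Fin ℓ, p j.succ = v ∧ ∀ i ≤ j.castSucc, p i ≠ v := by
  obtain ⟨i, hi, hmin⟩ := WellFounded.has_min (wellFounded_lt (α := Fin (ℓ + 1)))
    {i | p i = v} (hp v)
  have hi0 : i ≠ 0 := by
    rintro rfl
    exact hv (Eq.symm hi)
  obtain ⟨j, rfl⟩ := Fin.exists_succ_eq.2 hi0
  refine ⟨j, hi, fun i' hi' h => hmin i' h ?_⟩
  exact lt_of_le_of_lt hi' (Fin.castSucc_lt_succ)


section counts
variable {ℓ : ℕ} {V : Type*} [DecidableEq V]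

/-- number of diagonal steps at `v` with exponent `1` -/
def rc (ε : Fin ℓ → Bool) (p : Fin (ℓ + 1) → V) (v : V) : ℕ :=
  (Finset.univ.filter fun j : Fin ℓ => p j.castSucc = v ∧ p j.succ = v ∧ ε j = true).card

/-- number of diagonal steps at `v` with exponent `*` -/
def sc (ε : Fin ℓ → Bool) (p : Fin (ℓ + 1) → V) (v : V) : ℕ :=
  (Finset.univ.filter fun j : Fin ℓ => p j.castSucc = v ∧ p j.succ = v ∧ ε j = false).card

/-- number of uses of the matrix entry `(a,b)` -/
def ac (ε : Fin ℓ → Bool) (p : Fin (ℓ + 1) → V) (a b : V) : ℕ :=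
  (Finset.univ.filter fun j : Fin ℓ =>
    p j.castSucc ≠ p j.succ ∧ p j.castSucc = a ∧ p j.succ = b ∧ ε j = true).card

/-- number of uses of the conjugate of the matrix entry `(a,b)` -/
def bc (ε : Fin ℓ → Bool) (p : Fin (ℓ + 1) → V) (a b : V) : ℕ :=
  (Finset.univ.filter fun j : Fin ℓ =>
    p j.castSucc ≠ p j.succ ∧ p j.castSucc = b ∧ p j.succ = a ∧ ε j = false).card

/-- number of off-diagonal steps -/
def mc (p : Fin (ℓ + 1) → V) : ℕ :=
  (Finset.univ.filter fun j : Fin ℓ => p j.castSucc ≠ p j.succ).card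

lemma pow_card_filter {J : Type*} [Fintype J] (P : J → Prop) [DecidablePred P] (x : ℂ) :
    x ^ (Finset.univ.filter P).card = ∏ j, if P j then x else 1 := by
  rw [Finset.prod_ite]; simp

lemma rc_le (ε : Fin ℓ → Bool) (p : Fin (ℓ + 1) → V) (v : V) : rc ε p v < ℓ + 1 := by
  have := Finset.card_filter_le (Finset.univ : Finset (Fin ℓ))
    (fun j : Fin ℓ => p j.castSucc = v ∧ p j.succ = v ∧ ε j = true)
  simp only [Finset.card_univ, Fintype.card_fin] at this
  unfold rc; omega

lemma sc_le (ε : Fin ℓ → Bool) (p : Fin (ℓ + 1) → V) (v : V) : sc ε p v < ℓ + 1 := by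
  have := Finset.card_filter_le (Finset.univ : Finset (Fin ℓ))
    (fun j : Fin ℓ => p j.castSucc = v ∧ p j.succ = v ∧ ε j = false)
  simp only [Finset.card_univ, Fintype.card_fin] at this
  unfold sc; omega

variable [Fintype V]

lemma mc_eq_sum (ε : Fin ℓ → Bool) (p : Fin (ℓ + 1) → V) :
    mc p = ∑ a, ∑ b, (ac ε p a b + bc ε p a b) := by
  simp only [mc, ac, bc, Finset.card_filter, Finset.sum_add_distrib]
  have h1 : ∀ f : V → V → Fin ℓ → ℕ, ∑ a, ∑ b, ∑ j, f a b j = ∑ j, ∑ a, ∑ b, f a b j := by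
    intro f
    simp_rw [Finset.sum_comm (s := Finset.univ (α := V)) (t := Finset.univ (α := Fin ℓ))]
  rw [h1, h1, ← Finset.sum_add_distrib]
  refine Finset.sum_congr rfl fun j _ => ?_
  by_cases h : p j.castSucc = p j.succ
  · simp [h]
  · cases hε : ε j <;> simp [h, ite_and]

lemma weight_sum (ε : Fin ℓ → Bool) (p : Fin (ℓ + 1) → V) :
    mc p + ∑ v, (rc ε p v + sc ε p v) = ℓ := by
  simp only [mc, rc, sc, Finset.card_filter, Finset.sum_add_distrib]
  rw [Finset.sum_comm, Finset.sum_comm (s := Finset.univ (α := V)), ← Finset.sum_add_distrib,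
    ← Finset.sum_add_distrib]
  trans ∑ j : Fin ℓ, 1
  · refine Finset.sum_congr rfl fun j _ => ?_
    by_cases h : p j.castSucc = p j.succ
    · cases hε : ε j <;> simp [h]
    · cases hε : ε j <;> simp [h, Ne.symm h, ite_and]
  · simp

lemma prod_steps (ε : Fin ℓ → Bool) (p : Fin (ℓ + 1) → V) (c : ℂ) (d : V → ℂ) (T : V → V → ℂ) :
    ∏ j : Fin ℓ, (if p j.castSucc = p j.succ then
        (if ε j then d (p j.succ) else starRingEnd ℂ (d (p j.succ)))
      else c * (if ε j then T (p j.castSucc) (p j.succ) else starRingEnd ℂ (T (p j.succ) (p j.castSucc))))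
    = c ^ mc p * ((∏ v, (d v ^ rc ε p v * starRingEnd ℂ (d v) ^ sc ε p v)) *
      ∏ a, ∏ b, (T a b ^ ac ε p a b * starRingEnd ℂ (T a b) ^ bc ε p a b)) := by
  simp only [mc, ac, bc, rc, sc, pow_card_filter, Finset.prod_mul_distrib]
  have h1 : ∀ f : V → V → Fin ℓ → ℂ, ∏ a, ∏ b, ∏ j, f a b j = ∏ j, ∏ a, ∏ b, f a b j := by
    intro f
    simp_rw [Finset.prod_comm (s := Finset.univ (α := V)) (t := Finset.univ (α := Fin ℓ))]
  have h2 : ∀ f : V → Fin ℓ → ℂ, ∏ a, ∏ j, f a j = ∏ j, ∏ a, f a j := by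
    intro f
    rw [Finset.prod_comm]
  rw [h1, h1, h2, h2, ← Finset.prod_mul_distrib, ← Finset.prod_mul_distrib,
    ← Finset.prod_mul_distrib, ← Finset.prod_mul_distrib]
  refine Finset.prod_congr rfl fun j _ => ?_
  by_cases h : p j.castSucc = p j.succ
  · cases hε : ε j <;> simp [h]
  · have h' : ∀ v, ¬ (p j.castSucc = v ∧ p j.succ = v) := fun v hv => h (hv.1.trans hv.2.symm)
    have h'' : ∀ v b, ¬ (p j.castSucc = v ∧ p j.succ = v ∧ ε j = b) :=
      fun v b hv => h (hv.1.trans hv.2.1.symm)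
    simp only [h'', h]
    cases hε : ε j <;> simp [ite_and, Finset.prod_ite_irrel, h]

lemma card_le_edges (ε : Fin ℓ → Bool) (p : Fin (ℓ + 1) → V) (hp : Function.Surjective p)
    (hab : ∀ a b, ac ε p a b = bc ε p a b) :
    2 * Fintype.card V ≤ mc p + 2 := by
  have hm : mc p = 2 * ∑ x : V × V, ac ε p x.1 x.2 := by
    rw [mc_eq_sum ε p, Fintype.sum_prod_type]
    simp_rw [← hab, Finset.mul_sum, two_mul]
  have hex : ∀ v : {v : V // v ≠ p 0}, ∃ j : Fin ℓ, p j.succ = v ∧ ∀ i ≤ j.castSucc, p i ≠ v :=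
    fun v => first_visit p hp v.1 v.2
  choose j hj1 hj2 using hex
  let f : {v : V // v ≠ p 0} → V × V := fun v =>
    if ε (j v) then (p (j v).castSucc, v.1) else (v.1, p (j v).castSucc)
  have hf : ∀ v, 1 ≤ ac ε p (f v).1 (f v).2 := by
    intro v
    have hne : p (j v).castSucc ≠ p (j v).succ := by
      rw [hj1]; exact hj2 v _ le_rfl
    cases hε : ε (j v)
    · rw [hab]
      simp only [f, hε, bc]
      apply Finset.card_pos.2
      exact ⟨j v, by simp [hj1, hε]; exact hj2 v _ le_rfl⟩
    · simp only [f, hε, ac]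
      apply Finset.card_pos.2
      exact ⟨j v, by simp [hj1, hε]; exact hj2 v _ le_rfl⟩
  have hinj : Function.Injective f := by
    intro v w hvw
    by_contra hne
    have hne' : v.1 ≠ w.1 := fun h => hne (Subtype.ext h)
    have key : v.1 = p (j w).castSucc ∧ w.1 = p (j v).castSucc := by
      simp only [f] at hvw
      split_ifs at hvw with h1 h2 h2 <;> simp only [Prod.mk.injEq] at hvw
      · exact absurd hvw.2 hne'
      · exact ⟨hvw.2, hvw.1.symm⟩
      · exact ⟨hvw.1, hvw.2.symm⟩
      · exact absurd hvw.1 hne'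
    have h1 : (j v).castSucc < (j w).castSucc ∨ (j w).castSucc ≤ (j v).castSucc := lt_or_ge _ _
    rcases h1 with h1 | h1
    · exact hj2 w _ h1.le key.2.symm
    · exact hj2 v _ h1 key.1.symm
  have hcard : Fintype.card {v : V // v ≠ p 0} = Fintype.card V - 1 := by
    rw [Fintype.card_subtype_compl]; simp
  have hle : Fintype.card {v : V // v ≠ p 0} ≤ ∑ x : V × V, ac ε p x.1 x.2 := by
    calc Fintype.card {v : V // v ≠ p 0} = ∑ v : {v : V // v ≠ p 0}, 1 := by simp
      _ ≤ ∑ v : {v : V // v ≠ p 0}, ac ε p (f v).1 (f v).2 := Finset.sum_le_sum fun v _ => hf v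
      _ = ∑ x ∈ Finset.univ.map ⟨f, hinj⟩, ac ε p x.1 x.2 := by rw [Finset.sum_map]; rfl
      _ ≤ ∑ x : V × V, ac ε p x.1 x.2 :=
        Finset.sum_le_sum_of_subset (Finset.subset_univ _)
  omega
end counts

noncomputable def Gc {ℓ k : ℕ} (ε : Fin ℓ → Bool) (p : Fin (ℓ + 1) → Fin k) : ℝ :=
  ∏ a : Fin k, ∏ b : Fin k, if (a : ℕ) < (b : ℕ) then gmom (ac ε p a b) (bc ε p a b)
    else 0 ^ (ac ε p a b + bc ε p a b)

noncomputable def Wc {ℓ k : ℕ} (μ : Measure ℂ) (ε : Fin ℓ → Bool) (p : Fin (ℓ + 1) → Fin k) : ℂ :=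
  ∏ v, ∫ z : ℂ, z ^ rc ε p v * (starRingEnd ℂ z) ^ sc ε p v ∂μ

lemma Gc_nonneg {ℓ k : ℕ} (ε : Fin ℓ → Bool) (p : Fin (ℓ + 1) → Fin k) : 0 ≤ Gc ε p := by
  unfold Gc
  refine Finset.prod_nonneg fun a _ => Finset.prod_nonneg fun b _ => ?_
  split_ifs
  · exact gmom_nonneg _ _
  · positivity

lemma ac_eq_bc_of_Gc {ℓ k : ℕ} (ε : Fin ℓ → Bool) (p : Fin (ℓ + 1) → Fin k) (h : Gc ε p ≠ 0)
    (a b : Fin k) : ac ε p a b = bc ε p a b := by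
  unfold Gc at h
  have h1 := Finset.prod_ne_zero_iff.1 (Finset.prod_ne_zero_iff.1 h a (Finset.mem_univ _)) b
    (Finset.mem_univ _)
  by_contra hne
  split_ifs at h1 with hlt
  · exact h1 (gmom_ne hne)
  · exact h1 (zero_pow (by omega))

noncomputable instance entry_prob (P : Prop) [Decidable P] (v : ℝ≥0) :
    IsProbabilityMeasure (if P then complexGaussian v else Measure.dirac 0) := by
  split_ifs <;> infer_instance

lemma gt_diag (n : ℕ) (a : Fin n) : ∀ᵐ T ∂(GTlaw n), T a a = 0 := by
  unfold GTlaw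
  have h1 : ∀ᵐ z ∂(if (a : ℕ) < (a : ℕ) then complexGaussian ((n : ℝ≥0))⁻¹ else Measure.dirac 0),
      z = 0 := by
    simp
  have h2 := (measurePreserving_eval (fun j : Fin n => if (a : ℕ) < (j : ℕ) then
    complexGaussian ((n : ℝ≥0))⁻¹ else Measure.dirac 0) a).quasiMeasurePreserving.ae h1
  exact (measurePreserving_eval (fun i : Fin n => Measure.pi fun j : Fin n =>
    if (i : ℕ) < (j : ℕ) then
    complexGaussian ((n : ℝ≥0))⁻¹ else Measure.dirac 0) a).quasiMeasurePreserving.ae h2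

instance gt_prob (n : ℕ) : IsProbabilityMeasure (GTlaw n) := by
  unfold GTlaw; infer_instance

lemma entry_integrable (P : Prop) [Decidable P] (v : ℝ≥0) (a b : ℕ) :
    Integrable (fun z : ℂ => z ^ a * (starRingEnd ℂ z) ^ b)
      (if P then complexGaussian v else Measure.dirac 0) := by
  split_ifs
  · exact cg_integrable v a b
  · exact integrable_dirac enorm_lt_top

lemma entry_moment (P : Prop) [Decidable P] (n : ℕ) (a b : ℕ) :
    ∫ z : ℂ, z ^ a * (starRingEnd ℂ z) ^ b
      ∂(if P then complexGaussian (n : ℝ≥0)⁻¹ else Measure.dirac 0)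
    = ((Real.sqrt n)⁻¹ : ℂ) ^ (a + b) * ((if P then gmom a b else 0 ^ (a + b) : ℝ) : ℂ) := by
  split_ifs
  · exact cg_moment n a b
  · rw [integral_dirac]
    by_cases h : a + b = 0
    · obtain ⟨rfl, rfl⟩ : a = 0 ∧ b = 0 := by omega
      simp
    · rcases Nat.eq_zero_or_pos a with ha | ha
      · have : b ≠ 0 := by omega
        simp [this]
      · simp [ha.ne']

lemma mu_integrable (μ : Measure ℂ) [IsProbabilityMeasure μ]
    (hK : ∃ K : Set ℂ, IsCompact K ∧ μ Kᶜ = 0) (a b : ℕ) :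
    Integrable (fun z : ℂ => z ^ a * (starRingEnd ℂ z) ^ b) μ := by
  obtain ⟨K, hK, h0⟩ := hK
  have hc : ContinuousOn (fun z : ℂ => z ^ a * (starRingEnd ℂ z) ^ b) K :=
    Continuous.continuousOn (by fun_prop)
  obtain ⟨C, hC⟩ := hK.exists_bound_of_continuousOn hc
  refine Integrable.of_bound (by fun_prop) C ?_
  filter_upwards [mem_ae_iff.2 h0] with z hz
  exact hC z hz

section expect
variable {ℓ n : ℕ} (ε : Fin ℓ → Bool) (p : Fin (ℓ + 1) → Fin n) (μ : Measure ℂ)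
  [IsProbabilityMeasure μ] (c : ℝ)

/-- The path weight. -/
noncomputable def pw {ℓ n : ℕ} (ε : Fin ℓ → Bool) (p : Fin (ℓ + 1) → Fin n) (c : ℝ)
    (x : (Fin n → ℂ) × (Fin n → Fin n → ℂ)) : ℂ :=
  ∏ j : Fin ℓ, (if ε j then Matrix.diagonal x.1 + (c : ℂ) • Matrix.of x.2
                      else (Matrix.diagonal x.1 + (c : ℂ) • Matrix.of x.2)ᴴ)
    (p j.castSucc) (p j.succ)

lemma pw_ae : pw ε p c =ᵐ[(Measure.pi fun _ : Fin n => μ).prod (GTlaw n)]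
    fun x => (c : ℂ) ^ mc p * ((∏ v, (x.1 v ^ rc ε p v * starRingEnd ℂ (x.1 v) ^ sc ε p v)) *
      ∏ a, ∏ b, (x.2 a b ^ ac ε p a b * starRingEnd ℂ (x.2 a b) ^ bc ε p a b)) := by
  have h : ∀ᵐ x ∂((Measure.pi fun _ : Fin n => μ).prod (GTlaw n)), ∀ a, x.2 a a = 0 :=
    Measure.quasiMeasurePreserving_snd.ae (ae_all_iff.2 (gt_diag n))
  filter_upwards [h] with x hx
  rw [← prod_steps ε p (c : ℂ) x.1 x.2]
  unfold pw
  refine Finset.prod_congr rfl fun j _ => ?_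
  by_cases hj : p j.castSucc = p j.succ
  · cases hε : ε j <;> simp [hj, hx]
  · have hj' : ¬ p j.succ = p j.castSucc := fun h => hj h.symm
    cases hε : ε j <;> simp [hj, hj']

lemma pw_integrable (hK : ∃ K : Set ℂ, IsCompact K ∧ μ Kᶜ = 0) :
    Integrable (pw ε p c) ((Measure.pi fun _ : Fin n => μ).prod (GTlaw n)) := by
  rw [integrable_congr (pw_ae ε p μ c)]
  apply Integrable.const_mul
  refine Integrable.mul_prod (f := fun d : Fin n → ℂ =>
      ∏ v, (d v ^ rc ε p v * starRingEnd ℂ (d v) ^ sc ε p v))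
    (g := fun T : Fin n → Fin n → ℂ =>
      ∏ a, ∏ b, (T a b ^ ac ε p a b * starRingEnd ℂ (T a b) ^ bc ε p a b)) ?_ ?_
  · exact Integrable.fintype_prod (f := fun v z => z ^ rc ε p v * starRingEnd ℂ z ^ sc ε p v)
      fun v => mu_integrable μ hK _ _
  · unfold GTlaw
    refine Integrable.fintype_prod (f := fun a (t : Fin n → ℂ) =>
      ∏ b, (t b ^ ac ε p a b * starRingEnd ℂ (t b) ^ bc ε p a b)) fun a => ?_
    exact Integrable.fintype_prod (f := fun b z => z ^ ac ε p a b * starRingEnd ℂ z ^ bc ε p a b)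
      fun b => entry_integrable _ _ _ _

lemma pw_integral :
    ∫ x, pw ε p c x ∂((Measure.pi fun _ : Fin n => μ).prod (GTlaw n))
      = (c : ℂ) ^ mc p * (((Real.sqrt n)⁻¹ : ℂ) ^ mc p * (Wc μ ε p * (Gc ε p : ℂ))) := by
  rw [integral_congr_ae (pw_ae ε p μ c), integral_const_mul]
  congr 1
  rw [integral_prod_mul (fun d : Fin n → ℂ =>
      ∏ v, (d v ^ rc ε p v * starRingEnd ℂ (d v) ^ sc ε p v))
    (fun T : Fin n → Fin n → ℂ =>
      ∏ a, ∏ b, (T a b ^ ac ε p a b * starRingEnd ℂ (T a b) ^ bc ε p a b))]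
  rw [integral_fintype_prod_eq_prod (fun v z => z ^ rc ε p v * starRingEnd ℂ z ^ sc ε p v)]
  unfold GTlaw
  rw [integral_fintype_prod_eq_prod (fun a (t : Fin n → ℂ) =>
      ∏ b, (t b ^ ac ε p a b * starRingEnd ℂ (t b) ^ bc ε p a b))]
  have : ∀ a : Fin n, ∫ t : Fin n → ℂ, ∏ b, (t b ^ ac ε p a b * starRingEnd ℂ (t b) ^ bc ε p a b)
      ∂(Measure.pi fun b : Fin n => if (a : ℕ) < (b : ℕ) then complexGaussian ((n : ℝ≥0))⁻¹
        else Measure.dirac 0) = ∏ b, (((Real.sqrt n)⁻¹ : ℂ) ^ (ac ε p a b + bc ε p a b) *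
          ((if (a : ℕ) < (b : ℕ) then gmom (ac ε p a b) (bc ε p a b) else
            0 ^ (ac ε p a b + bc ε p a b) : ℝ) : ℂ)) := by
    intro a
    rw [integral_fintype_prod_eq_prod (fun b z => z ^ ac ε p a b * starRingEnd ℂ z ^ bc ε p a b)]
    exact Finset.prod_congr rfl fun b _ => entry_moment _ _ _ _
  simp_rw [this]
  simp_rw [Finset.prod_mul_distrib, Finset.prod_pow_eq_pow_sum]
  rw [← mc_eq_sum ε p]
  unfold Wc Gc
  push_cast
  ring
end expect

section invariance
variable {ℓ k n : ℕ} (ε : Fin ℓ → Bool) (e : Fin k ↪o Fin n) (π : Fin (ℓ + 1) → Fin k)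

lemma mc_inv : mc (fun j => e (π j)) = mc π := by
  simp [mc]

lemma Wc_inv (μ : Measure ℂ) [IsProbabilityMeasure μ] :
    Wc μ ε (fun j => e (π j)) = Wc μ ε π := by
  unfold Wc
  symm
  refine Fintype.prod_of_injective e e.injective _ _ ?_ ?_
  · intro i hi
    have hi' : ∀ x, e x ≠ i := fun x hx => hi ⟨x, hx⟩
    simp [rc, sc, hi']
  · intro i
    simp [rc, sc]

lemma Gc_inv : Gc ε (fun j => e (π j)) = Gc ε π := by
  unfold Gc
  symm
  refine Fintype.prod_of_injective e e.injective _ _ ?_ ?_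
  · intro i hi
    have hi' : ∀ x, e x ≠ i := fun x hx => hi ⟨x, hx⟩
    simp [ac, bc, hi', gmom_zero]
  · intro i
    refine Fintype.prod_of_injective e e.injective _ _ ?_ ?_
    · intro i hi
      have hi' : ∀ x, e x ≠ i := fun x hx => hi ⟨x, hx⟩
      simp [ac, bc, hi', gmom_zero]
    · intro i'
      simp [ac, bc]
end invariance

lemma choose_lim (k m : ℕ) (g : ℂ) (h : g ≠ 0 → Even m ∧ 2 * k ≤ m + 2) :
    Filter.Tendsto (fun n : ℕ => (n : ℂ)⁻¹ * ((n.choose k : ℂ) * (((Real.sqrt n)⁻¹ : ℂ) ^ m * g)))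
      Filter.atTop (nhds (if m + 2 = 2 * k then g / (k.factorial : ℂ) else 0)) := by
  by_cases hg : g = 0
  · subst hg; simp
  obtain ⟨⟨q, hq⟩, hk⟩ := h hg
  have hb : Filter.Tendsto (fun n : ℕ => (n.choose k : ℝ) / (n : ℝ) ^ k) Filter.atTop
      (nhds ((k.factorial : ℝ)⁻¹)) := by
    have h1 := isEquivalent_choose k
    have h2 : Filter.Tendsto (fun n : ℕ => (n ^ k / k.factorial : ℝ) / (n : ℝ) ^ k) Filter.atTop
      (nhds ((k.factorial : ℝ)⁻¹)) := by
      refine tendsto_const_nhds.congr' ?_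
      filter_upwards [Filter.eventually_gt_atTop 0] with n hn
      have : (n : ℝ) ≠ 0 := by positivity
      field_simp
    exact ((h1.div Asymptotics.IsEquivalent.refl).tendsto_nhds_iff).2 h2
  have hb' : Filter.Tendsto (fun n : ℕ => ((n.choose k : ℂ) / (n : ℂ) ^ k)) Filter.atTop
      (nhds ((k.factorial : ℂ)⁻¹)) := by
    have := (Complex.continuous_ofReal.tendsto _).comp hb
    simpa [Function.comp_def] using this
  have hsq : ∀ n : ℕ, ((Real.sqrt n)⁻¹ : ℂ) ^ m = ((n : ℂ) ^ q)⁻¹ := by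
    intro n
    rw [hq, ← two_mul, pow_mul, inv_pow, inv_pow]
    congr 2
    rw [← Complex.ofReal_pow, Real.sq_sqrt (by positivity)]
    simp
  simp_rw [hsq]
  have hinv : Filter.Tendsto (fun n : ℕ => ((n : ℂ))⁻¹) Filter.atTop (nhds 0) := by
    exact tendsto_inv_atTop_nhds_zero_nat
  obtain ⟨r, hr⟩ : ∃ r, q + 1 = k + r := ⟨q + 1 - k, by omega⟩
  have hlim := (hb'.mul (hinv.pow r)).mul_const g
  have heq : (if m + 2 = 2 * k then g / (k.factorial : ℂ) else 0)
      = (k.factorial : ℂ)⁻¹ * 0 ^ r * g := by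
    split_ifs with h'
    · have : r = 0 := by omega
      subst this; simp; ring
    · have : r ≠ 0 := by omega
      simp [this]
  rw [heq]
  refine hlim.congr fun n => ?_
  have : (n : ℂ)⁻¹ * ((n : ℂ) ^ q)⁻¹ = ((n : ℂ) ^ k)⁻¹ * ((n : ℂ)⁻¹) ^ r := by
    rw [← mul_inv, ← pow_succ', hr, pow_add, mul_inv, inv_pow]
  rw [div_eq_mul_inv]
  linear_combination (-(n.choose k : ℂ) * g) * this

/-- the patterns -/
abbrev Pat (ℓ k : ℕ) : Type := {π : Fin (ℓ + 1) → Fin k // Function.Surjective π}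

noncomputable def patExp {ℓ k : ℕ} (ε : Fin ℓ → Bool) (π : Fin (ℓ + 1) → Fin k) :
    Option (Fin (ℓ + 1) × Fin (ℓ + 1)) →₀ ℕ :=
  Finsupp.single none (mc π / 2) +
    ∑ v, Finsupp.single (some (⟨rc ε π v, rc_le ε π v⟩, ⟨sc ε π v, sc_le ε π v⟩)) 1

noncomputable def patCoeff {ℓ k : ℕ} (ε : Fin ℓ → Bool) (π : Fin (ℓ + 1) → Fin k) : ℝ :=
  if π 0 = π (Fin.last ℓ) then
    (if mc π + 2 = 2 * k then Gc ε π / (k.factorial : ℝ) else 0) else 0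

noncomputable def limPoly {ℓ : ℕ} (ε : Fin ℓ → Bool) :
    MvPolynomial (Option (Fin (ℓ + 1) × Fin (ℓ + 1))) ℝ :=
  ∑ k : Fin (ℓ + 2), ∑ π : Pat ℓ k, MvPolynomial.monomial (patExp ε π.1) (patCoeff ε π.1)

lemma limPoly_coeff {ℓ : ℕ} (ε : Fin ℓ → Bool) (d) : 0 ≤ (limPoly ε).coeff d := by
  unfold limPoly
  simp only [MvPolynomial.coeff_sum, MvPolynomial.coeff_monomial]
  refine Finset.sum_nonneg fun k _ => Finset.sum_nonneg fun π _ => ?_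
  have := Gc_nonneg ε π.1
  unfold patCoeff
  split_ifs <;> positivity

lemma limPoly_homog {ℓ : ℕ} (ε : Fin ℓ → Bool) :
    (limPoly ε).IsWeightedHomogeneous (momentWeight ℓ) ℓ := by
  unfold limPoly
  refine MvPolynomial.IsWeightedHomogeneous.sum _ _ _ fun k _ =>
    MvPolynomial.IsWeightedHomogeneous.sum _ _ _ fun π _ => ?_
  by_cases h : mc π.1 + 2 = 2 * (k : ℕ)
  · apply MvPolynomial.isWeightedHomogeneous_monomial
    have := weight_sum ε π.1
    simp only [patExp, map_add, map_sum, Finsupp.weight_single, momentWeight, smul_eq_mul, one_mul]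
    omega
  · have : patCoeff ε π.1 = 0 := by simp [patCoeff, h]
    rw [this, map_zero]
    exact MvPolynomial.isWeightedHomogeneous_zero _ _ _

noncomputable def evalPt (ℓ : ℕ) (μ : Measure ℂ) (c : ℝ) (v : Option (Fin (ℓ + 1) × Fin (ℓ + 1))) : ℂ :=
  match v with
  | none => (c : ℂ) ^ 2
  | some (r, s) => ∫ z : ℂ, z ^ (r : ℕ) * (starRingEnd ℂ z) ^ (s : ℕ) ∂μ

lemma limPoly_eval {ℓ : ℕ} (ε : Fin ℓ → Bool) (μ : Measure ℂ) (c : ℝ) :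
    MvPolynomial.aeval (evalPt ℓ μ c) (limPoly ε) =
      ∑ k : Fin (ℓ + 2), ∑ π : Pat ℓ k, if π.1 0 = π.1 (Fin.last ℓ) then
        (c : ℂ) ^ mc π.1 * (Wc μ ε π.1 *
          (if mc π.1 + 2 = 2 * (k : ℕ) then (Gc ε π.1 : ℂ) / ((k : ℕ).factorial : ℂ) else 0)) else 0 := by
  unfold limPoly
  simp only [map_sum, MvPolynomial.aeval_monomial]
  refine Finset.sum_congr rfl fun k _ => Finset.sum_congr rfl fun π _ => ?_
  unfold patCoeff
  split_ifs with h1 h2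
  · have hm : mc π.1 = 2 * (mc π.1 / 2) := by omega
    rw [patExp, Finsupp.prod_add_index' (by simp) (by intros; rw [pow_add]),
      ← Finsupp.prod_finsetSum_index (by simp) (by intros; rw [pow_add])]
    simp only [Finsupp.prod_single_index, pow_zero, pow_one, evalPt]
    rw [← pow_mul, ← hm]
    simp [Wc]
    ring
  · simp
  · simp

theorem main_lim {ℓ : ℕ} (ε : Fin ℓ → Bool) (μ : Measure ℂ) [IsProbabilityMeasure μ]
    (hK : ∃ K : Set ℂ, IsCompact K ∧ μ Kᶜ = 0) (c : ℝ) :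
    Filter.Tendsto
            (fun n : ℕ =>
              ∫ x : (Fin n → ℂ) × (Fin n → Fin n → ℂ),
                (n : ℂ)⁻¹ *
                  ((List.ofFn fun j : Fin ℓ =>
                      if ε j then Matrix.diagonal x.1 + (c : ℂ) • Matrix.of x.2
                      else (Matrix.diagonal x.1 + (c : ℂ) • Matrix.of x.2)ᴴ).prod).trace
                ∂((Measure.pi fun _ : Fin n => μ).prod (GTlaw n)))
            Filter.atTop (nhds (MvPolynomial.aeval (evalPt ℓ μ c) (limPoly ε))) := by
  have hint : ∀ n : ℕ, (∫ x : (Fin n → ℂ) × (Fin n → Fin n → ℂ),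
                (n : ℂ)⁻¹ *
                  ((List.ofFn fun j : Fin ℓ =>
                      if ε j then Matrix.diagonal x.1 + (c : ℂ) • Matrix.of x.2
                      else (Matrix.diagonal x.1 + (c : ℂ) • Matrix.of x.2)ᴴ).prod).trace
                ∂((Measure.pi fun _ : Fin n => μ).prod (GTlaw n)))
      = ∑ k : Fin (ℓ + 2), ∑ π : Pat ℓ k, if π.1 0 = π.1 (Fin.last ℓ) then
        (c : ℂ) ^ mc π.1 * (Wc μ ε π.1 * ((n : ℂ)⁻¹ * ((n.choose k : ℂ) *
          (((Real.sqrt n)⁻¹ : ℂ) ^ mc π.1 * (Gc ε π.1 : ℂ))))) else 0 := by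
    intro n
    rw [integral_const_mul]
    have h1 : ∀ x : (Fin n → ℂ) × (Fin n → Fin n → ℂ), ((List.ofFn fun j : Fin ℓ =>
                      if ε j then Matrix.diagonal x.1 + (c : ℂ) • Matrix.of x.2
                      else (Matrix.diagonal x.1 + (c : ℂ) • Matrix.of x.2)ᴴ).prod).trace
        = ∑ p : Fin (ℓ + 1) → Fin n, if p 0 = p (Fin.last ℓ) then pw ε p c x else 0 :=
      fun x => path_trace ℓ _
    simp_rw [h1]
    rw [integral_finsetSum]
    swap
    · intro p _
      split_ifs
      · exact pw_integrable ε p μ c hK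
      · exact integrable_zero _ _ _
    rw [sum_patterns, Finset.mul_sum]
    refine Finset.sum_congr rfl fun k _ => ?_
    rw [Finset.sum_comm, Finset.mul_sum]
    refine Finset.sum_congr rfl fun π _ => ?_
    have h2 : ∀ e : Fin (k : ℕ) ↪o Fin n, (∫ x, (if e (π.1 0) = e (π.1 (Fin.last ℓ)) then
        pw ε (fun j => e (π.1 j)) c x else 0) ∂((Measure.pi fun _ : Fin n => μ).prod (GTlaw n)))
        = if π.1 0 = π.1 (Fin.last ℓ) then (c : ℂ) ^ mc π.1 * (((Real.sqrt n)⁻¹ : ℂ) ^ mc π.1 *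
          (Wc μ ε π.1 * (Gc ε π.1 : ℂ))) else 0 := by
      intro e
      simp only [e.injective.eq_iff]
      split_ifs
      · rw [pw_integral, mc_inv, Wc_inv, Gc_inv]
      · simp
    simp_rw [h2]
    rw [Finset.sum_const, Finset.card_univ, card_emb]
    split_ifs
    · rw [nsmul_eq_mul]; ring
    · simp
  simp_rw [hint]
  rw [limPoly_eval]
  refine tendsto_finsetSum _ fun k _ => tendsto_finsetSum _ fun π _ => ?_
  by_cases h0 : π.1 0 = π.1 (Fin.last ℓ)
  · simp only [if_pos h0]
    refine Filter.Tendsto.const_mul _ (Filter.Tendsto.const_mul _ ?_)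
    refine choose_lim _ _ _ fun hg => ?_
    have hg' : Gc ε π.1 ≠ 0 := by exact_mod_cast hg
    have hab := ac_eq_bc_of_Gc ε π.1 hg'
    constructor
    · rw [mc_eq_sum ε π.1]
      refine Finset.even_sum _ fun a _ => Finset.even_sum _ fun b _ => ?_
      rw [hab]; exact ⟨_, rfl⟩
    · simpa using card_le_edges ε π.1 π.2 hab
  · simp only [if_neg h0]
    exact tendsto_const_nhds

/-- Every limit `*`-moment of the `DT(μ,c)` random matrix model `Z_n = D_n + c·T_n` exists
and is given by a universal polynomial, with nonnegative coefficients, in `c²` and the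
moments `M_μ(r,s)`, weighted-homogeneous of degree `ℓ` for `deg c = 1`,
`deg M_μ(r,s) = r+s`. Here `ε(j) = true` encodes `Z_n` and `ε(j) = false` encodes `Z_n*`. -/
theorem stmt19 (ℓ : ℕ) (hl : 1 ≤ ℓ) (ε : Fin ℓ → Bool) :
    ∃ P : MvPolynomial (Option (Fin (ℓ + 1) × Fin (ℓ + 1))) ℝ,
      (∀ d, 0 ≤ P.coeff d) ∧
      P.IsWeightedHomogeneous (momentWeight ℓ) ℓ ∧
      ∀ (μ : Measure ℂ), IsProbabilityMeasure μ → (∃ K : Set ℂ, IsCompact K ∧ μ Kᶜ = 0) →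
        ∀ c : ℝ, 0 < c →
          Filter.Tendsto
            (fun n : ℕ =>
              ∫ x : (Fin n → ℂ) × (Fin n → Fin n → ℂ),
                (n : ℂ)⁻¹ *
                  ((List.ofFn fun j : Fin ℓ =>
                      if ε j then Matrix.diagonal x.1 + (c : ℂ) • Matrix.of x.2
                      else (Matrix.diagonal x.1 + (c : ℂ) • Matrix.of x.2)ᴴ).prod).trace
                ∂((Measure.pi fun _ : Fin n => μ).prod (GTlaw n)))
            Filter.atTop
            (nhds (MvPolynomial.aeval
              (fun v : Option (Fin (ℓ + 1) × Fin (ℓ + 1)) =>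
                match v with
                | none => (c : ℂ) ^ 2
                | some (r, s) =>
                    ∫ z : ℂ, z ^ (r : ℕ) * (starRingEnd ℂ z) ^ (s : ℕ) ∂μ) P)) := by
  refine ⟨limPoly ε, limPoly_coeff ε, limPoly_homog ε, fun μ hμ hK c _ => ?_⟩
  have h := main_lim ε μ hK c
  have he : evalPt ℓ μ c = (fun v : Option (Fin (ℓ + 1) × Fin (ℓ + 1)) =>
                match v with
                | none => (c : ℂ) ^ 2
                | some (r, s) =>
                    ∫ z : ℂ, z ^ (r : ℕ) * (starRingEnd ℂ z) ^ (s : ℕ) ∂μ) := by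
    funext v
    rcases v with _ | ⟨r, s⟩ <;> rfl
  rw [he] at h
  exact h
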